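/- arXiv:1106.5559 — 6 statements merged into one kernel-verified Lean document; each statement's English description precedes it below -/
import Mathlib

section
/- (Eisenstein–Hermite finiteness) For every natural number n and every positive integer D, there are only finitely many equivalence classes of symmetric positive definite matrices Q in Matrix (Fin n) (Fin n) ℤ with det Q ≤ D, under the congruence relation Q₁ ∼ Q₂ iff there exists U ∈ GL (Fin n) ℤ with Q₂ = Uᵀ * Q₁ * U. -/
open Matrix

namespace EH

def Pd {n : ℕ} (Q : Matrix (Fin n) (Fin n) ℤ) : Prop :=
  Q.IsSymm ∧ ∀ v : Fin n → ℤ, v ≠ 0 → 0 < v ⬝ᵥ (Q *ᵥ v)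

def Cg {n : ℕ} (Q Q' : Matrix (Fin n) (Fin n) ℤ) : Prop :=
  ∃ U : Matrix (Fin n) (Fin n) ℤ, IsUnit U.det ∧ Q' = Uᵀ * Q * U

theorem Cg.refl {n : ℕ} (Q : Matrix (Fin n) (Fin n) ℤ) : Cg Q Q := ⟨1, by simp, by simp⟩

theorem Cg.trans {n : ℕ} {Q Q' Q'' : Matrix (Fin n) (Fin n) ℤ} (h : Cg Q Q') (h' : Cg Q' Q'') :
    Cg Q Q'' := by
  obtain ⟨U, hU, rfl⟩ := h
  obtain ⟨V, hV, rfl⟩ := h'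
  refine ⟨U * V, by rw [det_mul]; exact hU.mul hV, ?_⟩
  simp only [transpose_mul, Matrix.mul_assoc]

theorem Cg.pd {n : ℕ} {Q Q' : Matrix (Fin n) (Fin n) ℤ} (h : Cg Q Q') (hQ : Pd Q) : Pd Q' := by
  obtain ⟨U, hU, rfl⟩ := h
  refine ⟨?_, fun v hv => ?_⟩
  · have := hQ.1.eq
    simp only [IsSymm, transpose_mul, transpose_transpose, this, Matrix.mul_assoc]
  · have h1 : U *ᵥ v ≠ 0 := by
      intro h0
      apply hv
      have : U⁻¹ *ᵥ (U *ᵥ v) = v := by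
        rw [mulVec_mulVec, nonsing_inv_mul _ hU, one_mulVec]
      rw [← this, h0, mulVec_zero]
    have h2 := hQ.2 _ h1
    have : v ⬝ᵥ (Uᵀ * Q * U) *ᵥ v = (U *ᵥ v) ⬝ᵥ (Q *ᵥ (U *ᵥ v)) := by
      rw [Matrix.mul_assoc, ← mulVec_mulVec, ← mulVec_mulVec, dotProduct_mulVec, vecMul_transpose]
    rw [this]; exact h2

theorem Cg.det {n : ℕ} {Q Q' : Matrix (Fin n) (Fin n) ℤ} (h : Cg Q Q') : Q'.det = Q.det := by
  obtain ⟨U, hU, rfl⟩ := h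
  rw [det_mul, det_mul, det_transpose]
  rcases Int.isUnit_iff.1 hU with h | h <;> rw [h] <;> ring

theorem Cg.perm {n : ℕ} (Q : Matrix (Fin n) (Fin n) ℤ) (σ : Equiv.Perm (Fin n)) :
    Cg Q (Q.submatrix σ σ) := by
  refine ⟨(1 : Matrix (Fin n) (Fin n) ℤ).submatrix id σ, ?_, ?_⟩
  · rw [det_permute']
    simp
  · ext i j
    simp [Matrix.mul_apply, Matrix.one_apply]

def Blk {n : ℕ} (a : ℤ) (r c : Fin n → ℤ) (M : Matrix (Fin n) (Fin n) ℤ) :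
    Matrix (Fin (n+1)) (Fin (n+1)) ℤ :=
  Matrix.of (Fin.cons (Fin.cons a r) (fun i => Fin.cons (c i) (M i)))

theorem Blk_transpose {n : ℕ} (a : ℤ) (r c : Fin n → ℤ) (M : Matrix (Fin n) (Fin n) ℤ) :
    (Blk a r c M)ᵀ = Blk a c r Mᵀ := by
  ext i j
  refine Fin.cases ?_ (fun i => ?_) i <;> refine Fin.cases ?_ (fun j => ?_) j <;> simp [Blk]

theorem Blk_mul {n : ℕ} (a a' : ℤ) (r c r' c' : Fin n → ℤ) (M M' : Matrix (Fin n) (Fin n) ℤ) :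
    Blk a r c M * Blk a' r' c' M' =
      Blk (a * a' + r ⬝ᵥ c') (a • r' + r ᵥ* M') (a' • c + M *ᵥ c')
        (vecMulVec c r' + M * M') := by
  ext i j
  refine Fin.cases ?_ (fun i => ?_) i <;> refine Fin.cases ?_ (fun j => ?_) j <;>
    simp [Blk, Matrix.mul_apply, Fin.sum_univ_succ, dotProduct, vecMul, mulVec, vecMulVec, mul_comm]

theorem Blk_eta {n : ℕ} (Q : Matrix (Fin (n+1)) (Fin (n+1)) ℤ) :
    Q = Blk (Q 0 0) (fun j => Q 0 j.succ) (fun i => Q i.succ 0) (Q.submatrix Fin.succ Fin.succ) := by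
  ext i j
  refine Fin.cases ?_ (fun i => ?_) i <;> refine Fin.cases ?_ (fun j => ?_) j <;> simp [Blk]

theorem Blk_det {n : ℕ} (a : ℤ) (r : Fin n → ℤ) (M : Matrix (Fin n) (Fin n) ℤ) :
    (Blk a r 0 M).det = a * M.det := by
  rw [det_succ_column_zero, Fin.sum_univ_succ]
  have : (Blk a r 0 M).submatrix (Fin.succAbove 0) Fin.succ = M := by
    ext i j; simp [Blk]
  rw [this]
  simp [Blk]

/-- the complement form -/
def Rd {n : ℕ} (Q : Matrix (Fin (n+1)) (Fin (n+1)) ℤ) : Matrix (Fin n) (Fin n) ℤ :=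
  Q 0 0 • Q.submatrix Fin.succ Fin.succ - vecMulVec (fun j => Q 0 j.succ) (fun j => Q 0 j.succ)

theorem Rd_Blk {n : ℕ} (a : ℤ) (b c : Fin n → ℤ) (M : Matrix (Fin n) (Fin n) ℤ) :
    Rd (Blk a b c M) = a • M - vecMulVec b b := by
  ext i j; simp [Rd, Blk, -zsmul_eq_mul]

theorem symm_Blk {n : ℕ} {Q : Matrix (Fin (n+1)) (Fin (n+1)) ℤ} (h : Q.IsSymm) :
    ∃ (a : ℤ) (b : Fin n → ℤ) (M : Matrix (Fin n) (Fin n) ℤ), M.IsSymm ∧ Q = Blk a b b M := by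
  refine ⟨Q 0 0, fun j => Q 0 j.succ, Q.submatrix Fin.succ Fin.succ, h.submatrix _, ?_⟩
  have : (fun j : Fin n => Q 0 j.succ) = fun i => Q i.succ 0 := by
    ext j; exact h.apply _ _
  conv_rhs => enter [3]; rw [this]
  exact Blk_eta Q

theorem Pd.pos {n : ℕ} {Q : Matrix (Fin n) (Fin n) ℤ} (h : Pd Q) (i : Fin n) : 0 < Q i i := by
  have := h.2 (Pi.single i 1) (by simp)
  simpa using this

theorem Rd_det {n : ℕ} {Q : Matrix (Fin (n+1)) (Fin (n+1)) ℤ} (h : Q.IsSymm) :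
    Q 0 0 ^ n * Q.det = Q 0 0 * (Rd Q).det := by
  obtain ⟨a, b, M, hM, rfl⟩ := symm_Blk h
  rw [Rd_Blk]
  have h0 : (Blk a b b M) 0 0 = a := rfl
  rw [h0]
  have h1 : Blk 1 0 (-b) (a • (1 : Matrix (Fin n) (Fin n) ℤ)) * Blk a b b M
      = Blk a b 0 (a • M - vecMulVec b b) := by
    rw [Blk_mul]
    congr 1
    · simp
    · simp
    · simp [smul_mulVec, -zsmul_eq_mul]
    · rw [neg_vecMulVec, smul_mul, Matrix.one_mul]; abel
  have h2 : (Blk 1 0 (-b) (a • (1 : Matrix (Fin n) (Fin n) ℤ))).det = a ^ n := by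
    rw [← det_transpose, Blk_transpose, Blk_det]
    rw [transpose_smul, transpose_one, det_smul]
    simp
  rw [← Blk_det a b, ← h1, det_mul, h2]

theorem Rd_pd {n : ℕ} {Q : Matrix (Fin (n+1)) (Fin (n+1)) ℤ} (h : Pd Q) : Pd (Rd Q) := by
  have ha := h.pos 0
  obtain ⟨a, b, M, hM, rfl⟩ := symm_Blk h.1
  have ha : 0 < a := ha
  rw [Rd_Blk]
  refine ⟨?_, fun v hv => ?_⟩
  · ext i j
    have := hM.apply i j
    simp [vecMulVec, this, mul_comm, -zsmul_eq_mul]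
  · have h1 := h.2 (Fin.cons (-(b ⬝ᵥ v)) (a • v)) (by
      intro h0
      apply hv
      ext i
      have := congrFun h0 i.succ
      simp at this
      simpa [ha.ne'] using this)
    have hB : (Blk a b b M) *ᵥ (Fin.cons (-(b ⬝ᵥ v)) (a • v)) =
        Fin.cons 0 (-(b ⬝ᵥ v) • b + a • (M *ᵥ v)) := by
      ext i
      refine Fin.cases ?_ (fun i => ?_) i
      · simp [Blk, mulVec, dotProduct, Fin.sum_univ_succ, Finset.mul_sum, mul_left_comm]
      · simp [Blk, mulVec, dotProduct, Fin.sum_univ_succ, Finset.mul_sum, mul_left_comm]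
        rw [← Finset.mul_sum, mul_comm]
    have hC : ∀ (s t : ℤ) (x y : Fin n → ℤ), (Fin.cons s x : Fin (n+1) → ℤ) ⬝ᵥ (Fin.cons t y)
        = s * t + x ⬝ᵥ y := by
      intro s t x y
      simp [dotProduct, Fin.sum_univ_succ]
    rw [hB, hC] at h1
    have hD : v ⬝ᵥ (a • M - vecMulVec b b) *ᵥ v = -(b ⬝ᵥ v) * (b ⬝ᵥ v) + a * (v ⬝ᵥ M *ᵥ v) := by
      rw [sub_mulVec, smul_mulVec, vecMulVec_mulVec, dotProduct_sub]
      simp [dotProduct_comm v b, -zsmul_eq_mul]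
      ring
    rw [hD]
    simp [dotProduct_add, dotProduct_comm v b, -zsmul_eq_mul] at h1
    have : 0 < a * (-(b ⬝ᵥ v) * (b ⬝ᵥ v) + a * (v ⬝ᵥ M *ᵥ v)) := by linarith
    exact pos_of_mul_pos_right this ha.le

theorem round_ex (a x : ℤ) (ha : 0 < a) : ∃ t : ℤ, 2 * |a * t + x| ≤ a := by
  refine ⟨-((2 * x + a) / (2 * a)), ?_⟩
  have h1 := Int.mul_ediv_add_emod (2 * x + a) (2 * a)
  have h2 := Int.emod_nonneg (2 * x + a) (b := 2 * a) (by omega)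
  have h3 := Int.emod_lt_of_pos (2 * x + a) (b := 2 * a) (by omega)
  have : ∀ y : ℤ, -a ≤ 2 * y → 2 * y ≤ a → 2 * |y| ≤ a := by
    intro y _ _
    rcases abs_cases y with h | h <;> omega
  apply this <;> nlinarith

theorem step {n : ℕ} {Q : Matrix (Fin (n+1)) (Fin (n+1)) ℤ} (h : Pd Q)
    (V : Matrix (Fin n) (Fin n) ℤ) (hV : IsUnit V.det) :
    ∃ Q', Cg Q Q' ∧ Q' 0 0 = Q 0 0 ∧ (∀ j : Fin n, 2 * |Q' 0 j.succ| ≤ Q 0 0) ∧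
      Rd Q' = Vᵀ * Rd Q * V := by
  have ha := h.pos 0
  obtain ⟨a, b, M, hM, rfl⟩ := symm_Blk h.1
  have ha : 0 < a := ha
  choose t ht using fun j => round_ex a ((b ᵥ* V) j) ha
  have key : (Blk 1 t 0 V)ᵀ * Blk a b b M * Blk 1 t 0 V =
      Blk a (a • t + b ᵥ* V) (a • t + b ᵥ* V) (vecMulVec (a • t + b ᵥ* V) t +
        (vecMulVec t (b ᵥ* V) + Vᵀ * M * V)) := by
    rw [Blk_transpose, Blk_mul, Blk_mul]
    congr 1
    · simp
    · simp
    · simp [mulVec_transpose]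
    · simp [mulVec_transpose, Matrix.add_mul, vecMulVec_mul]
  refine ⟨_, ⟨Blk 1 t 0 V, by rw [Blk_det]; simpa using hV, rfl⟩, ?_, ?_, ?_⟩
  · rw [key]; rfl
  · intro j
    rw [key]
    simpa [Blk] using ht j
  · rw [key, Rd_Blk, Rd_Blk, Matrix.mul_sub, Matrix.sub_mul, mul_vecMulVec, vecMulVec_mul,
      mulVec_transpose]
    ext i j
    simp [vecMulVec, -zsmul_eq_mul]
    ring

theorem exists_min {n : ℕ} (Q : Matrix (Fin (n+1)) (Fin (n+1)) ℤ) (h : Pd Q) :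
    ∃ Q', Cg Q Q' ∧ ∀ Q'', Cg Q' Q'' → Q' 0 0 ≤ Q'' 0 0 := by
  classical
  have hex : ∃ k : ℕ, ∃ Q', Cg Q Q' ∧ (Q' 0 0).toNat = k := ⟨_, Q, Cg.refl Q, rfl⟩
  obtain ⟨Q', hc, hk⟩ := Nat.find_spec hex
  refine ⟨Q', hc, fun Q'' hc' => ?_⟩
  have h1 := Nat.find_min' hex ⟨Q'', hc.trans hc', rfl⟩
  have h2 := (hc.pd h).pos 0
  have h3 := ((hc.trans hc').pd h).pos 0
  omega

theorem hermite (n : ℕ) : ∃ c : ℤ, 0 < c ∧ ∀ Q : Matrix (Fin (n+1)) (Fin (n+1)) ℤ, Pd Q →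
    ∃ Q', Cg Q Q' ∧ (Q' 0 0) ^ (n+1) ≤ c * Q.det := by
  induction n with
  | zero => exact ⟨1, one_pos, fun Q _ => ⟨Q, Cg.refl Q, by simp⟩⟩
  | succ n ih =>
    obtain ⟨c, hc, ih⟩ := ih
    refine ⟨4 ^ (n+1) * c, by positivity, fun Q₀ hQ₀ => ?_⟩
    obtain ⟨Q, hQQ, hmin⟩ := exists_min Q₀ hQ₀
    have hQ := hQQ.pd hQ₀
    refine ⟨Q, hQQ, ?_⟩
    rw [← hQQ.det]
    obtain ⟨R', ⟨V, hV, hR'⟩, hr⟩ := ih (Rd Q) (Rd_pd hQ)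
    obtain ⟨Q', hQ', h00, hb, hRd⟩ := step hQ V hV
    have hswap := hmin _ (hQ'.trans (Cg.perm Q' (Equiv.swap 0 1)))
    simp at hswap
    have hr0 : Q 0 0 * Q' 1 1 - Q' 0 1 * Q' 0 1 = R' 0 0 := by
      rw [hR', ← hRd, ← h00]
      simp [Rd, vecMulVec, -zsmul_eq_mul]
    have hb0 := hb 0
    simp at hb0
    have ha := hQ.pos 0
    have hdet := Rd_det hQ.1
    set a := Q 0 0
    set r := R' 0 0
    have h1 : 4 * (Q' 0 1 * Q' 0 1) ≤ a * a := by
      have := abs_nonneg (Q' 0 1)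
      have h := abs_mul_abs_self (Q' 0 1)
      nlinarith
    have h2 : a ^ 2 ≤ 4 * r := by nlinarith
    have h3 : (a ^ 2) ^ (n+1) ≤ (4 * r) ^ (n+1) := by gcongr
    have h4 : a ^ (n+1) * a ^ (n+2) ≤ a ^ (n+1) * (4 ^ (n+1) * c * Q.det) := by
      calc a ^ (n+1) * a ^ (n+2) = a * (a ^ 2) ^ (n+1) := by ring
        _ ≤ a * (4 * r) ^ (n+1) := by gcongr
        _ = a * 4 ^ (n+1) * r ^ (n+1) := by ring
        _ ≤ a * 4 ^ (n+1) * (c * (Rd Q).det) := by gcongr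
        _ = 4 ^ (n+1) * c * (a * (Rd Q).det) := by ring
        _ = _ := by rw [← hdet]; ring
    exact le_of_mul_le_mul_left h4 (by positivity)

theorem reduced (n : ℕ) : ∀ D : ℤ, ∃ B : ℤ, ∀ Q : Matrix (Fin n) (Fin n) ℤ, Pd Q → Q.det ≤ D →
    ∃ Q', Cg Q Q' ∧ ∀ i j, |Q' i j| ≤ B := by
  induction n with
  | zero => exact fun D => ⟨0, fun Q _ _ => ⟨Q, Cg.refl Q, fun i => i.elim0⟩⟩
  | succ n ih =>
    intro D
    obtain ⟨c, hc, hH⟩ := hermite n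
    obtain ⟨B, hB⟩ := ih ((c * D) ^ n * D)
    refine ⟨|B| + (c * D) ^ 2 + c * D, fun Q₀ hQ₀ hD => ?_⟩
    obtain ⟨Q, hQQ, ha⟩ := hH Q₀ hQ₀
    have hQ := hQQ.pd hQ₀
    rw [← hQQ.det] at ha hD
    have hapos := hQ.pos 0
    have hdet := Rd_det hQ.1
    have haA : Q 0 0 ≤ c * D := by
      calc Q 0 0 ≤ Q 0 0 ^ (n+1) := le_self_pow₀ (by omega) (by omega)
        _ ≤ c * Q.det := ha
        _ ≤ c * D := by gcongr
    have hdpos : 0 < Q.det := by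
      have : 0 < c * Q.det := lt_of_lt_of_le (by positivity) ha
      exact pos_of_mul_pos_right this hc.le
    have hRpos : 0 < (Rd Q).det := by
      have : 0 < Q 0 0 * (Rd Q).det := by rw [← hdet]; positivity
      exact pos_of_mul_pos_right this hapos.le
    have hRd : (Rd Q).det ≤ (c * D) ^ n * D := by
      calc (Rd Q).det ≤ Q 0 0 * (Rd Q).det := by nlinarith
        _ = Q 0 0 ^ n * Q.det := hdet.symm
        _ ≤ _ := by
          have : 0 ≤ c * D := by omega
          gcongr
    obtain ⟨R', ⟨V, hV, hR'⟩, hRB⟩ := hB _ (Rd_pd hQ) hRd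
    obtain ⟨Q', hQ', h00, hb, hRd'⟩ := step hQ V hV
    refine ⟨Q', hQQ.trans hQ', ?_⟩
    have hsym := (hQ'.pd hQ).1
    rw [← hRd'] at hR'
    have hBn := abs_nonneg B
    have hb' : ∀ j : Fin n, |Q' 0 j.succ| ≤ c * D := fun j => by
      have := hb j
      have := abs_nonneg (Q' 0 j.succ)
      omega
    have hsq : 0 ≤ (c * D) ^ 2 := by positivity
    intro i j
    refine Fin.cases ?_ (fun i => ?_) i <;> refine Fin.cases ?_ (fun j => ?_) j
    · rw [h00, abs_of_pos hapos]; omega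
    · have := hb' j; omega
    · rw [← hsym.apply]; have := hb' i; omega
    · have h1 : Q 0 0 * Q' i.succ j.succ = R' i j + Q' 0 i.succ * Q' 0 j.succ := by
        rw [hR', ← h00]; simp [Rd, vecMulVec, -zsmul_eq_mul]
      have h2 : |Q' i.succ j.succ| ≤ Q 0 0 * |Q' i.succ j.succ| := by
        have := abs_nonneg (Q' i.succ j.succ)
        nlinarith
      have h3 : Q 0 0 * |Q' i.succ j.succ| = |R' i j + Q' 0 i.succ * Q' 0 j.succ| := by
        rw [← h1, abs_mul, abs_of_pos hapos]
      have h4 := abs_add_le (R' i j) (Q' 0 i.succ * Q' 0 j.succ)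
      have h5 : |Q' 0 i.succ * Q' 0 j.succ| ≤ (c * D) ^ 2 := by
        rw [abs_mul, sq]
        exact mul_le_mul (hb' i) (hb' j) (abs_nonneg _) (by omega)
      have h6 := (hRB i j).trans (le_abs_self B)
      omega

end EH

/-- **Eisenstein–Hermite finiteness.**  For every natural number `n` and every positive
integer `D`, there are only finitely many congruence classes of symmetric positive definite
integer matrices `Q` of size `n × n` with `det Q ≤ D`, where `Q₁` and `Q₂` are congruent iff
there is `U ∈ GL (Fin n) ℤ` with `Q₂ = Uᵀ * Q₁ * U`. -/
theorem eisenstein_hermite_finiteness (n : ℕ) (D : ℤ) (hD : 0 < D) :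
    Finite (Quot (fun Q₁ Q₂ : {Q : Matrix (Fin n) (Fin n) ℤ //
        Q.IsSymm ∧ (∀ v : Fin n → ℤ, v ≠ 0 → 0 < v ⬝ᵥ (Q *ᵥ v)) ∧ Q.det ≤ D} =>
      ∃ U : Matrix.GeneralLinearGroup (Fin n) ℤ,
        (Q₂ : Matrix (Fin n) (Fin n) ℤ) =
          (U : Matrix (Fin n) (Fin n) ℤ)ᵀ * (Q₁ : Matrix (Fin n) (Fin n) ℤ) *
            (U : Matrix (Fin n) (Fin n) ℤ))) := by
  classical
  obtain ⟨B, hB⟩ := EH.reduced n D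
  have hfin : {Q : Matrix (Fin n) (Fin n) ℤ | ∀ i j, |Q i j| ≤ B}.Finite := by
    have : (Set.univ.pi fun _ : Fin n => Set.univ.pi fun _ : Fin n => Set.Icc (-B) B).Finite :=
      Set.Finite.pi fun _ => Set.Finite.pi fun _ => Set.finite_Icc _ _
    refine this.subset fun Q hQ i _ j _ => ?_
    exact abs_le.1 (hQ i j)
  have : Finite {Q : {Q : Matrix (Fin n) (Fin n) ℤ //
        Q.IsSymm ∧ (∀ v : Fin n → ℤ, v ≠ 0 → 0 < v ⬝ᵥ (Q *ᵥ v)) ∧ Q.det ≤ D} //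
        ∀ i j, |Q.1 i j| ≤ B} := by
    have := hfin.to_subtype
    exact Finite.of_injective
      (β := {Q : Matrix (Fin n) (Fin n) ℤ | ∀ i j, |Q i j| ≤ B})
      (fun Q => ⟨Q.1.1, Q.2⟩) (fun Q Q' h => by
        apply Subtype.ext; apply Subtype.ext
        simpa using h)
  refine Finite.of_surjective (fun Q : {Q : {Q : Matrix (Fin n) (Fin n) ℤ //
        Q.IsSymm ∧ (∀ v : Fin n → ℤ, v ≠ 0 → 0 < v ⬝ᵥ (Q *ᵥ v)) ∧ Q.det ≤ D} //
        ∀ i j, |Q.1 i j| ≤ B} => Quot.mk _ Q.1) ?_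
  intro q
  induction q using Quot.ind with
  | mk Q =>
    obtain ⟨Q', hc, hb⟩ := hB Q.1 ⟨Q.2.1, Q.2.2.1⟩ Q.2.2.2
    have hp := hc.pd ⟨Q.2.1, Q.2.2.1⟩
    refine ⟨⟨⟨Q', hp.1, hp.2, hc.det.trans_le Q.2.2.2⟩, hb⟩, ?_⟩
    symm
    apply Quot.sound
    obtain ⟨U, hU, h⟩ := hc
    exact ⟨Matrix.GeneralLinearGroup.mk'' U hU, h⟩
end

section
/- Let Q ∈ Matrix (Fin n) (Fin n) ℤ be symmetric with det Q ≠ 0. Then the set of characteristic vectors of Q decomposes into exactly |det Q| classes modulo the subgroup 2·Q(ℤⁿ): the image of {χ : Fin n → ℤ | ∀ i, χ i ≡ Q i i (mod 2)} in the quotient group (Fin n → ℤ) ⧸ {2 • (Q *ᵥ v) | v : Fin n → ℤ} is a finite set of cardinality |det Q|. -/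
open Matrix

/-- For a symmetric integer matrix `Q` with `det Q ≠ 0`, the image of the set of
characteristic vectors of `Q` in the quotient of `ℤⁿ` by the subgroup `2·Q(ℤⁿ)` is a
finite set with exactly `|det Q|` elements. -/
theorem characteristic_vectors_card_classes (n : ℕ) (Q : Matrix (Fin n) (Fin n) ℤ)
    (hQ : Q.IsSymm) (hdet : Q.det ≠ 0) (S : AddSubgroup (Fin n → ℤ))
    (hS : (S : Set (Fin n → ℤ)) = {w : Fin n → ℤ | ∃ v : Fin n → ℤ, w = 2 • (Q *ᵥ v)}) :
    (((QuotientAddGroup.mk : (Fin n → ℤ) → (Fin n → ℤ) ⧸ S) ''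
        {χ : Fin n → ℤ | ∀ i : Fin n, χ i ≡ Q i i [ZMOD 2]}).Finite) ∧
      ((QuotientAddGroup.mk : (Fin n → ℤ) → (Fin n → ℤ) ⧸ S) ''
        {χ : Fin n → ℤ | ∀ i : Fin n, χ i ≡ Q i i [ZMOD 2]}).ncard = Q.det.natAbs := by
  have hmem : ∀ w, w ∈ S ↔ ∃ v : Fin n → ℤ, w = 2 • (Q *ᵥ v) := fun w => by
    rw [← SetLike.mem_coe, hS]; rfl
  have hinj : Function.Injective (Matrix.toLin' Q) := by
    intro a b hab
    rw [Matrix.toLin'_apply, Matrix.toLin'_apply] at hab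
    have h0 : Q *ᵥ (a - b) = 0 := by rw [Matrix.mulVec_sub, hab, sub_self]
    exact sub_eq_zero.mp (Matrix.eq_zero_of_mulVec_eq_zero hdet h0)
  set N : Submodule ℤ (Fin n → ℤ) := LinearMap.range (Matrix.toLin' Q) with hN
  have hcard : Nat.card ((Fin n → ℤ) ⧸ N) = Q.det.natAbs := by
    rw [← Submodule.natAbs_det_equiv N (LinearEquiv.ofInjective (Matrix.toLin' Q) hinj),
      ← LinearMap.det_toLin']
    rfl
  have hfin : Finite ((Fin n → ℤ) ⧸ N) := by
    apply Nat.finite_of_card_ne_zero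
    rw [hcard]
    exact Int.natAbs_ne_zero.mpr hdet
  let g : ((Fin n → ℤ) ⧸ N) → ((Fin n → ℤ) ⧸ S) :=
    fun q => QuotientAddGroup.mk ((fun i => Q i i) + 2 • Quotient.out q)
  have hout : ∀ q : (Fin n → ℤ) ⧸ N, (Submodule.Quotient.mk (Quotient.out q)) = q :=
    fun q => Quotient.out_eq q
  have hg : Function.Injective g := by
    intro p q hpq
    obtain ⟨v, hv⟩ := (hmem _).mp (QuotientAddGroup.eq.mp hpq)
    rw [← hout p, ← hout q]
    symm
    rw [Submodule.Quotient.eq]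
    refine ⟨v, ?_⟩
    rw [Matrix.toLin'_apply]
    funext i
    have := congrFun hv i
    simp at this ⊢
    linarith
  have himg : (QuotientAddGroup.mk : (Fin n → ℤ) → (Fin n → ℤ) ⧸ S) ''
        {χ : Fin n → ℤ | ∀ i : Fin n, χ i ≡ Q i i [ZMOD 2]} = Set.range g := by
    ext y
    constructor
    · rintro ⟨χ, hχ, rfl⟩
      choose x hx using fun i => (hχ i).symm.dvd
      refine ⟨Submodule.Quotient.mk x, ?_⟩
      obtain ⟨v, hv⟩ := (Submodule.Quotient.eq N).mp (hout (Submodule.Quotient.mk x)).symm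
      refine QuotientAddGroup.eq.mpr ((hmem _).mpr ⟨v, ?_⟩)
      rw [Matrix.toLin'_apply] at hv
      rw [hv]
      funext i
      have := hx i
      simp
      linarith
    · rintro ⟨q, rfl⟩
      refine ⟨_, fun i => ?_, rfl⟩
      simp [Int.ModEq]
  rw [himg]
  refine ⟨Set.finite_range g, ?_⟩
  rw [← hcard, ← Nat.card_coe_set_eq, Nat.card_range_of_injective hg]
end

section
/- Let Q ∈ Matrix (Fin n) (Fin n) ℚ be symmetric and negative definite, and let χ₀ : Fin n → ℚ. Then the function v ↦ (χ₀ + 2 • (Q *ᵥ v)) ⬝ᵥ (Q⁻¹ *ᵥ (χ₀ + 2 • (Q *ᵥ v))) on integer vectors v : Fin n → ℤ attains a maximum: there exists v₀ : Fin n → ℤ such that for all v : Fin n → ℤ, (χ₀ + 2 • (Q *ᵥ v)) ⬝ᵥ (Q⁻¹ *ᵥ (χ₀ + 2 • (Q *ᵥ v))) ≤ (χ₀ + 2 • (Q *ᵥ v₀)) ⬝ᵥ (Q⁻¹ *ᵥ (χ₀ + 2 • (Q *ᵥ v₀))). -/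
open Matrix

/-- For a symmetric negative definite rational matrix `Q` and a vector `χ₀`, the quadratic
quantity `(χ₀ + 2 Q v)ᵀ Q⁻¹ (χ₀ + 2 Q v)` attains a maximum over integer vectors `v`. -/
theorem max_square_over_characteristic_class (n : ℕ) (Q : Matrix (Fin n) (Fin n) ℚ)
    (hQ : Q.IsSymm) (hneg : ∀ v : Fin n → ℚ, v ≠ 0 → v ⬝ᵥ (Q *ᵥ v) < 0)
    (χ₀ : Fin n → ℚ) :
    ∃ v₀ : Fin n → ℤ, ∀ v : Fin n → ℤ,
      (χ₀ + 2 • (Q *ᵥ fun i => (v i : ℚ))) ⬝ᵥ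
          (Q⁻¹ *ᵥ (χ₀ + 2 • (Q *ᵥ fun i => (v i : ℚ)))) ≤
        (χ₀ + 2 • (Q *ᵥ fun i => (v₀ i : ℚ))) ⬝ᵥ
          (Q⁻¹ *ᵥ (χ₀ + 2 • (Q *ᵥ fun i => (v₀ i : ℚ)))) := by
  have hdet : Q.det ≠ 0 := by
    intro h
    obtain ⟨v, hv, h0⟩ := Matrix.exists_mulVec_eq_zero_iff.mpr h
    have := hneg v hv
    rw [h0] at this
    simp at this
  have hu : IsUnit Q.det := isUnit_iff_ne_zero.mpr hdet
  have hR : ∀ y : Fin n → ℚ, y ⬝ᵥ (Q⁻¹ *ᵥ y) ≤ 0 := by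
    intro y
    have h1 : Q *ᵥ (Q⁻¹ *ᵥ y) = y := by
      rw [Matrix.mulVec_mulVec, Matrix.mul_nonsing_inv _ hu, Matrix.one_mulVec]
    by_cases h0 : Q⁻¹ *ᵥ y = 0
    · rw [h0]; simp
    · have := hneg _ h0
      rw [h1, dotProduct_comm] at this
      exact this.le
  have hRs : ∀ x y : Fin n → ℚ, x ⬝ᵥ (Q⁻¹ *ᵥ y) = y ⬝ᵥ (Q⁻¹ *ᵥ x) := by
    intro x y
    have ht : (Q⁻¹)ᵀ = Q⁻¹ := by rw [Matrix.transpose_nonsing_inv, hQ.eq]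
    rw [Matrix.dotProduct_mulVec, dotProduct_comm, ← Matrix.mulVec_transpose, ht]
  set f : (Fin n → ℤ) → ℚ := fun v => (χ₀ + 2 • (Q *ᵥ fun i => (v i : ℚ))) ⬝ᵥ
          (Q⁻¹ *ᵥ (χ₀ + 2 • (Q *ᵥ fun i => (v i : ℚ)))) with hf
  change ∃ v₀, ∀ v, f v ≤ f v₀
  have key : ∀ (v : Fin n → ℤ) (i : Fin n),
      2 * ((Q⁻¹ *ᵥ χ₀) i + 2 * v i) ≤ - f v - Q⁻¹ i i ∧
      -(- f v - Q⁻¹ i i) ≤ 2 * ((Q⁻¹ *ᵥ χ₀) i + 2 * v i) := by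
    intro v i
    set x := χ₀ + 2 • (Q *ᵥ fun i => (v i : ℚ)) with hx
    have hfx : f v = x ⬝ᵥ (Q⁻¹ *ᵥ x) := rfl
    have hw : Pi.single i 1 ⬝ᵥ (Q⁻¹ *ᵥ x) = (Q⁻¹ *ᵥ χ₀) i + 2 * v i := by
      rw [single_one_dotProduct, hx, Matrix.mulVec_add, Matrix.mulVec_smul, Matrix.mulVec_mulVec,
        Matrix.nonsing_inv_mul _ hu, Matrix.one_mulVec]
      simp
    have hee : (Pi.single i 1 : Fin n → ℚ) ⬝ᵥ (Q⁻¹ *ᵥ Pi.single i 1) = Q⁻¹ i i := by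
      simp
    have h1 := hR (x + Pi.single i 1)
    have h2 := hR (x - Pi.single i 1)
    rw [Matrix.mulVec_add, add_dotProduct, dotProduct_add, dotProduct_add,
      hRs x (Pi.single i 1), hw, hee, ← hfx] at h1
    rw [Matrix.mulVec_sub, sub_dotProduct, dotProduct_sub, dotProduct_sub,
      hRs x (Pi.single i 1), hw, hee, ← hfx] at h2
    constructor <;> linarith
  have hfin : {v | f 0 ≤ f v}.Finite := by
    apply (Set.finite_Icc
      (fun i => ⌊(-(- f 0 - Q⁻¹ i i) / 2 - (Q⁻¹ *ᵥ χ₀) i) / 2⌋ : Fin n → ℤ)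
      (fun i => ⌈((- f 0 - Q⁻¹ i i) / 2 - (Q⁻¹ *ᵥ χ₀) i) / 2⌉)).subset
    intro v hv
    have hv' : f 0 ≤ f v := hv
    constructor
    · intro i
      have := (key v i).2
      have h : ((⌊(-(- f 0 - Q⁻¹ i i) / 2 - (Q⁻¹ *ᵥ χ₀) i) / 2⌋ : ℤ) : ℚ) ≤ v i :=
        (Int.floor_le _).trans (by linarith)
      exact_mod_cast h
    · intro i
      have := (key v i).1
      have h : (v i : ℚ) ≤ ((⌈((- f 0 - Q⁻¹ i i) / 2 - (Q⁻¹ *ᵥ χ₀) i) / 2⌉ : ℤ) : ℚ) :=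
        le_trans (by linarith) (Int.le_ceil _)
      exact_mod_cast h
  obtain ⟨v₀, h0, hmax⟩ := Set.exists_max_image _ f hfin ⟨0, le_refl (f 0)⟩
  refine ⟨v₀, fun v => ?_⟩
  by_cases h : f 0 ≤ f v
  · exact hmax v h
  · exact (not_le.mp h).le.trans h0
end

section
/- (Lattice-theoretic core of the quasi-alternating obstruction) For every positive integer D there exists a constant C : ℚ with the following property: for every natural number n < D, every symmetric negative definite matrix Q ∈ Matrix (Fin n) (Fin n) ℤ with |det Q| = D, and every vector χ₀ : Fin n → ℤ with χ₀ i ≡ Q i i (mod 2) for all i, there exists v : Fin n → ℤ such that ((χ₀ + 2 • (Q *ᵥ v)) ⬝ᵥ ((Q : Matrix (Fin n) (Fin n) ℚ)⁻¹ *ᵥ (χ₀ + 2 • (Q *ᵥ v))) + n) / 4 ≥ C. -/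
open Matrix

/-- integral positive definiteness -/
def QAPD {ι : Type} [Fintype ι] (P : Matrix ι ι ℤ) : Prop :=
  P.IsSymm ∧ ∀ v : ι → ℤ, v ≠ 0 → 0 < v ⬝ᵥ (P *ᵥ v)

/-- reduction statement -/
def QARed (ι : Type) [Fintype ι] [DecidableEq ι] : Prop :=
  ∃ c : ℤ, 0 ≤ c ∧ ∀ P : Matrix ι ι ℤ, QAPD P → ∃ U : Matrix ι ι ℤ, IsUnit U.det ∧
    ∏ i, (U * P * Uᵀ) i i ≤ c * P.det

lemma QAPD.congr {ι : Type} [Fintype ι] [DecidableEq ι] {P : Matrix ι ι ℤ} (hP : QAPD P)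
    {U : Matrix ι ι ℤ} (hU : IsUnit U.det) : QAPD (U * P * Uᵀ) := by
  refine ⟨?_, fun v hv => ?_⟩
  · have := hP.1
    unfold Matrix.IsSymm at *
    simp [Matrix.transpose_mul, this, Matrix.mul_assoc]
  · have h1 : v ⬝ᵥ ((U * P * Uᵀ) *ᵥ v) = (Uᵀ *ᵥ v) ⬝ᵥ (P *ᵥ (Uᵀ *ᵥ v)) := by
      rw [← Matrix.mulVec_mulVec, ← Matrix.mulVec_mulVec, Matrix.dotProduct_mulVec,
        ← Matrix.mulVec_transpose]
    rw [h1]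
    apply hP.2
    intro h0
    apply hv
    have hU' : IsUnit Uᵀ := by
      rw [Matrix.isUnit_iff_isUnit_det, Matrix.det_transpose]; exact hU
    exact (Matrix.mulVec_injective_of_isUnit hU') (by simpa using h0)

lemma QAPD.diag {ι : Type} [Fintype ι] [DecidableEq ι] {P : Matrix ι ι ℤ} (hP : QAPD P)
    (i : ι) : 0 < P i i := by
  have := hP.2 (Pi.single i 1) (by simp)
  simpa using this

lemma qa_det_congr {ι : Type} [Fintype ι] [DecidableEq ι] (P : Matrix ι ι ℤ)
    {U : Matrix ι ι ℤ} (hU : IsUnit U.det) : (U * P * Uᵀ).det = P.det := by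
  rw [Matrix.det_mul, Matrix.det_mul, Matrix.det_transpose]
  have := Int.isUnit_mul_self hU
  linear_combination P.det * this

lemma QARed.equiv {ι κ : Type} [Fintype ι] [DecidableEq ι] [Fintype κ] [DecidableEq κ]
    (e : ι ≃ κ) (h : QARed ι) : QARed κ := by
  obtain ⟨c, hc, H⟩ := h
  refine ⟨c, hc, fun P hP => ?_⟩
  have hP' : QAPD (P.submatrix e e) := by
    refine ⟨hP.1.submatrix e, fun v hv => ?_⟩
    have := hP.2 (v ∘ e.symm) (by
      intro h0; apply hv; funext i; simpa using congrFun h0 (e i))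
    rw [Matrix.submatrix_mulVec_equiv]
    rw [comp_equiv_symm_dotProduct] at this
    exact this
  obtain ⟨U, hU, h⟩ := H _ hP'
  refine ⟨U.submatrix e.symm e.symm, by simpa using hU, ?_⟩
  rw [Matrix.det_submatrix_equiv_self] at h
  refine le_trans (le_of_eq ?_) h
  rw [← e.prod_comp]
  refine Finset.prod_congr rfl fun i _ => ?_
  have : U.submatrix e.symm e.symm * P * (U.submatrix e.symm e.symm)ᵀ
     = (U * P.submatrix e e * Uᵀ).submatrix e.symm e.symm := by
    rw [← Matrix.submatrix_mul_equiv _ _ _ e.symm, ← Matrix.submatrix_mul_equiv _ _ _ e.symm]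
    simp
  rw [this]; simp

lemma qa_min {ι : Type} [Fintype ι] [DecidableEq ι] (o : ι) (P : Matrix ι ι ℤ) (hP : QAPD P) :
    ∃ U : Matrix ι ι ℤ, IsUnit U.det ∧ ∀ V : Matrix ι ι ℤ, IsUnit V.det → ∀ i,
      (U * P * Uᵀ) o o ≤ (V * P * Vᵀ) i i := by
  let S : Set ℕ := {m | ∃ V : Matrix ι ι ℤ, IsUnit V.det ∧ (V * P * Vᵀ) o o = m}
  have hS : S.Nonempty := by
    refine ⟨(P o o).toNat, 1, by simp, ?_⟩
    simp [(hP.diag o).le]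
  obtain ⟨U, hU, h⟩ := Nat.sInf_mem hS
  refine ⟨U, hU, fun V hV i => ?_⟩
  rw [h]
  have hW : IsUnit (V.submatrix (Equiv.swap o i) id).det := by
    rw [Matrix.det_permute]
    exact IsUnit.mul (by
      rcases Int.units_eq_one_or (Equiv.Perm.sign (Equiv.swap o i)) with h | h <;> simp [h]) hV
  have hv : (V.submatrix (Equiv.swap o i) id * P * (V.submatrix (Equiv.swap o i) id)ᵀ) o o
      = (V * P * Vᵀ) i i := by
    simp [Matrix.mul_apply]
  have hpos := (hP.congr hV).diag i
  have : sInf S ≤ ((V * P * Vᵀ) i i).toNat := Nat.sInf_le ⟨_, hW, by rw [hv]; omega⟩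
  omega

lemma qa_round (a b : ℤ) (ha : 0 < a) : ∃ s : ℤ, (2 * (a * s + b)) ^ 2 ≤ a ^ 2 := by
  refine ⟨-((2 * b + a) / (2 * a)), ?_⟩
  have h1 := Int.emod_add_mul_ediv (2 * b + a) (2 * a)
  have h2 := Int.emod_nonneg (2 * b + a) (b := 2 * a) (by omega)
  have h3 := Int.emod_lt_of_pos (2 * b + a) (b := 2 * a) (by omega)
  apply sq_le_sq'
  · nlinarith
  · nlinarith

lemma qa_step {ι : Type} [Fintype ι] [DecidableEq ι] (h : QARed ι) : QARed (Unit ⊕ ι) := by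
  obtain ⟨c, hc, H⟩ := h
  refine ⟨2 ^ Fintype.card ι * c, by positivity, fun P₀ hP₀ => ?_⟩
  obtain ⟨U₀, hU₀, hmin₀⟩ := qa_min (Sum.inl ()) P₀ hP₀
  set P := U₀ * P₀ * U₀ᵀ with hPdef
  have hP : QAPD P := hP₀.congr hU₀
  have hdet : P.det = P₀.det := qa_det_congr P₀ hU₀
  set a := P (Sum.inl ()) (Sum.inl ()) with ha
  have hmin : ∀ V : Matrix (Unit ⊕ ι) (Unit ⊕ ι) ℤ, IsUnit V.det → ∀ i, a ≤ (V * P * Vᵀ) i i := by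
    intro V hV i
    have := hmin₀ (V * U₀) (by rw [det_mul]; exact hV.mul hU₀) i
    simpa [-zsmul_eq_mul, -zsmul_one, hPdef, Matrix.transpose_mul, Matrix.mul_assoc] using this
  have hapos : 0 < a := hP.diag _
  set C : Matrix ι Unit ℤ := P.toBlocks₂₁ with hC
  set E : Matrix ι ι ℤ := P.toBlocks₂₂ with hE
  have hPb : P = fromBlocks (a • (1 : Matrix Unit Unit ℤ)) Cᵀ C E := by
    rw [← fromBlocks_toBlocks P]
    congr 1
    · ext i j; simp [-zsmul_eq_mul, -zsmul_one, toBlocks₁₁, ha]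
    · ext i j; simp [-zsmul_eq_mul, -zsmul_one, hC, toBlocks₁₂, toBlocks₂₁, hP.1.apply]
  have hEs : Eᵀ = E := by
    ext i j; simp [-zsmul_eq_mul, -zsmul_one, hE, toBlocks₂₂, hP.1.apply]
  set P' : Matrix ι ι ℤ := a • E - C * Cᵀ with hP'
  have hdetP' : a ^ Fintype.card ι * P.det = a * P'.det := by
    have h1 : (fromBlocks (1 : Matrix Unit Unit ℤ) 0 (-C) (a • (1 : Matrix ι ι ℤ))) * P
        = fromBlocks (a • (1 : Matrix Unit Unit ℤ)) Cᵀ 0 P' := by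
      rw [hPb, fromBlocks_multiply]
      congr 1 <;> simp [-zsmul_eq_mul, -zsmul_one, hP', sub_eq_add_neg, add_comm]
    have h2 := congrArg Matrix.det h1
    rw [det_mul, det_fromBlocks_zero₁₂, det_fromBlocks_zero₂₁] at h2
    simpa [-zsmul_eq_mul, -zsmul_one, det_smul] using h2
  have hP'pd : QAPD P' := by
    refine ⟨?_, fun v hv => ?_⟩
    · simp [-zsmul_eq_mul, -zsmul_one, Matrix.IsSymm, hP', hEs, Matrix.transpose_mul]
    · have h1 := hP.2 (Sum.elim (-(Cᵀ *ᵥ v)) (a • v)) (by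
        intro h0; apply hv; funext i
        have := congrFun h0 (Sum.inr i)
        simp at this
        rcases this with h | h
        · omega
        · simpa using h)
      have h2 : (Sum.elim (-(Cᵀ *ᵥ v)) (a • v)) ⬝ᵥ (P *ᵥ (Sum.elim (-(Cᵀ *ᵥ v)) (a • v)))
          = a * (v ⬝ᵥ (P' *ᵥ v)) := by
        rw [hPb, fromBlocks_mulVec]
        have e1 : (a • (1 : Matrix Unit Unit ℤ)) *ᵥ (-(Cᵀ *ᵥ v)) + Cᵀ *ᵥ (a • v) = 0 := by
          simp [-zsmul_eq_mul, -zsmul_one, smul_mulVec, mulVec_smul]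
        have e2 : C *ᵥ (-(Cᵀ *ᵥ v)) + E *ᵥ (a • v) = P' *ᵥ v := by
          simp [-zsmul_eq_mul, -zsmul_one, hP', sub_mulVec, smul_mulVec, mulVec_smul, mulVec_neg, mulVec_mulVec]
          abel
        simp only [Sum.elim_comp_inl, Sum.elim_comp_inr]
        rw [e1, e2, sumElim_dotProduct_sumElim]
        simp [-zsmul_eq_mul, -zsmul_one]
      rw [h2] at h1
      exact pos_of_mul_pos_right h1 hapos.le |> fun h => h
  obtain ⟨U, hU, hUp⟩ := H P' hP'pd
  choose s hs using fun i => qa_round a ((U * C) i ()) hapos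
  let sm : Matrix ι Unit ℤ := Matrix.of fun i _ => s i
  let V : Matrix (Unit ⊕ ι) (Unit ⊕ ι) ℤ := fromBlocks 1 0 sm U
  have hV : IsUnit V.det := by simpa [-zsmul_eq_mul, -zsmul_one, V] using hU
  set T : Matrix ι Unit ℤ := a • sm + U * C with hT
  set F : Matrix ι ι ℤ := (a • sm + U * C) * smᵀ + (sm * Cᵀ + U * E) * Uᵀ with hF
  have hR : V * P * Vᵀ = fromBlocks (a • (1 : Matrix Unit Unit ℤ)) Tᵀ T F := by
    rw [hPb]
    simp only [V, fromBlocks_transpose, fromBlocks_multiply]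
    congr 1 <;> simp [-zsmul_eq_mul, -zsmul_one, hT, hF, Matrix.transpose_mul]
  have hFT : a • F - T * Tᵀ = U * P' * Uᵀ := by
    simp only [hF, hT, hP', Matrix.transpose_add, Matrix.transpose_mul, Matrix.transpose_smul,
      Matrix.mul_add, Matrix.add_mul, Matrix.mul_sub, Matrix.sub_mul, Matrix.smul_mul,
      Matrix.mul_smul, smul_add, Matrix.mul_assoc]
    abel
  refine ⟨V * U₀, by rw [det_mul]; exact hV.mul hU₀, ?_⟩
  have hVU : V * U₀ * P₀ * (V * U₀)ᵀ = V * P * Vᵀ := by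
    simp [-zsmul_eq_mul, -zsmul_one, hPdef, Matrix.transpose_mul, Matrix.mul_assoc]
  rw [hVU, ← hdet, hR]
  simp only [Fintype.prod_sum_type, Finset.univ_unique, Finset.prod_singleton,
    fromBlocks_apply₁₁, fromBlocks_apply₂₂]
  have hkey : ∀ i, a * F i i ≤ 2 * (U * P' * Uᵀ) i i := by
    intro i
    have h1 : a ≤ F i i := by
      have := hmin V hV (Sum.inr i)
      rw [hR] at this; simpa using this
    have h2 : a * F i i - T i () * T i () = (U * P' * Uᵀ) i i := by
      rw [← hFT]; simp [-zsmul_eq_mul, -zsmul_one, Matrix.mul_apply]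
    have h3 : (2 * T i ()) ^ 2 ≤ a ^ 2 := by
      have := hs i
      simpa [-zsmul_eq_mul, -zsmul_one, hT, sm] using this
    nlinarith
  have hFpos : ∀ i, 0 < F i i := by
    intro i
    have := (hP.congr hV).diag (Sum.inr i)
    rw [hR] at this; simpa using this
  have hprod : a ^ Fintype.card ι * ∏ i, F i i ≤ 2 ^ Fintype.card ι * ∏ i, (U * P' * Uᵀ) i i := by
    have := Finset.prod_le_prod (s := Finset.univ) (f := fun i => a * F i i)
      (g := fun i => 2 * (U * P' * Uᵀ) i i)
      (fun i _ => (mul_pos hapos (hFpos i)).le) (fun i _ => hkey i)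
    simpa [-zsmul_eq_mul, -zsmul_one, Finset.prod_mul_distrib] using this
  have hfin : a ^ Fintype.card ι * (a * ∏ i, F i i) ≤
      a ^ Fintype.card ι * (2 ^ Fintype.card ι * c * P.det) := by
    calc _ = a * (a ^ Fintype.card ι * ∏ i, F i i) := by ring
      _ ≤ a * (2 ^ Fintype.card ι * (c * P'.det)) := by
        apply mul_le_mul_of_nonneg_left _ hapos.le
        exact hprod.trans (mul_le_mul_of_nonneg_left hUp (by positivity))
      _ = _ := by linear_combination (-(2 ^ Fintype.card ι * c)) * hdetP'
  have := le_of_mul_le_mul_left hfin (by positivity)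
  simpa using this

lemma qa_red (n : ℕ) : QARed (Fin n) := by
  induction n with
  | zero => exact ⟨1, by norm_num, fun P _ => ⟨1, by simp, by simp⟩⟩
  | succ n ih =>
    exact (qa_step ih).equiv ((Equiv.sumComm _ _).trans
      ((Equiv.sumCongr (Equiv.refl _) (finOneEquiv.symm)).trans finSumFinEquiv))

lemma qa_cover (n : ℕ) (D : ℤ) : ∃ K : ℚ, 0 ≤ K ∧ ∀ P : Matrix (Fin n) (Fin n) ℤ, QAPD P →
    P.det ≤ D → ∀ w : Fin n → ℚ, ∃ v : Fin n → ℤ,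
      (w - fun i => (v i : ℚ)) ⬝ᵥ (P.map (Int.cast : ℤ → ℚ) *ᵥ (w - fun i => (v i : ℚ))) ≤ K := by
  obtain ⟨c, hc, H⟩ := qa_red n
  refine ⟨n * n * |(c * D : ℚ)|, by positivity, fun P hP hPD w => ?_⟩
  obtain ⟨U, hU, hUp⟩ := H P hP
  set R := U * P * Uᵀ with hR
  have hRpd : QAPD R := hP.congr hU
  have hdiag : ∀ i, R i i ≤ c * D := by
    intro i
    refine le_trans ?_ (hUp.trans (mul_le_mul_of_nonneg_left hPD hc))
    exact Int.le_of_dvd (Finset.prod_pos fun j _ => hRpd.diag j)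
      (Finset.dvd_prod_of_mem (fun i => R i i) (Finset.mem_univ i))
  have hoff : ∀ i j, |R i j| ≤ c * D := by
    intro i j
    by_cases hij : i = j
    · subst hij
      rw [abs_of_pos (hRpd.diag i)]; exact hdiag i
    have hs := hRpd.1.apply i j
    have h1 := hRpd.2 (Pi.single i 1 + Pi.single j 1) (by
      intro h; have := congrFun h i; simp [hij] at this)
    have h2 := hRpd.2 (Pi.single i 1 - Pi.single j 1) (by
      intro h; have := congrFun h i; simp [hij] at this)
    simp [mulVec_add, add_dotProduct] at h1
    simp [mulVec_sub, sub_dotProduct] at h2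
    have := hdiag i
    have := hdiag j
    rw [abs_le]; constructor <;> omega
  let f := (Int.castRingHom ℚ)
  let Uq := U.map (Int.cast : ℤ → ℚ)
  have hUq : IsUnit Uqᵀ.det := by
    rw [det_transpose]
    have : Uq.det = ((U.det : ℤ) : ℚ) := by
      simpa [Uq] using (Int.cast_det (R := ℚ) U).symm
    rw [this]
    exact hU.map (Int.castRingHom ℚ)
  let z := Uqᵀ⁻¹ *ᵥ w
  let y : Fin n → ℚ := fun i => z i - round (z i)
  have hy : ∀ i, |y i| ≤ 1 := fun i => (abs_sub_round (z i)).trans (by norm_num)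
  refine ⟨Uᵀ *ᵥ fun i => round (z i), ?_⟩
  have hw : (w - fun i => (((Uᵀ *ᵥ fun i => round (z i)) i : ℤ) : ℚ)) = Uqᵀ *ᵥ y := by
    have e1 : y = z - fun i => ((round (z i) : ℤ) : ℚ) := rfl
    rw [e1, mulVec_sub, mulVec_mulVec, mul_nonsing_inv _ hUq, one_mulVec]
    congr 1
    funext i
    simp [Matrix.mulVec, dotProduct, Uq]
  rw [hw]
  have hRq : Uq * P.map (Int.cast : ℤ → ℚ) * Uqᵀ = R.map (Int.cast : ℤ → ℚ) := by
    ext i j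
    simp [hR, Uq, Matrix.mul_apply]
  have h1 : (Uqᵀ *ᵥ y) ⬝ᵥ (P.map (Int.cast : ℤ → ℚ) *ᵥ (Uqᵀ *ᵥ y))
      = y ⬝ᵥ (R.map (Int.cast : ℤ → ℚ) *ᵥ y) := by
    rw [← hRq, ← Matrix.mulVec_mulVec, ← Matrix.mulVec_mulVec,
      Matrix.dotProduct_mulVec y, ← Matrix.mulVec_transpose]
  rw [h1]
  have h2 : ∀ i j, y i * (R i j * y j) ≤ |(c * D : ℚ)| := by
    intro i j
    have hq : |(R i j : ℚ)| ≤ |(c * D : ℚ)| := by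
      refine le_trans ?_ (le_abs_self _)
      exact_mod_cast hoff i j
    calc y i * (R i j * y j) ≤ |y i * (R i j * y j)| := le_abs_self _
      _ = |y i| * (|(R i j : ℚ)| * |y j|) := by rw [abs_mul, abs_mul]
      _ ≤ 1 * (|(c * D : ℚ)| * 1) := by
        gcongr
        · exact hy i
        · exact hy j
      _ = _ := by ring
  calc y ⬝ᵥ (R.map (Int.cast : ℤ → ℚ) *ᵥ y) = ∑ i, ∑ j, y i * (R i j * y j) := by
        simp [dotProduct, mulVec, Finset.mul_sum]
    _ ≤ ∑ i : Fin n, ∑ j : Fin n, |(c * D : ℚ)| :=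
        Finset.sum_le_sum fun i _ => Finset.sum_le_sum fun j _ => h2 i j
    _ = _ := by simp [mul_assoc]

theorem qa_obstruction_lattice_bound (D : ℤ) (hD : 0 < D) :
    ∃ C : ℚ, ∀ n : ℕ, (n : ℤ) < D → ∀ Q : Matrix (Fin n) (Fin n) ℤ, Q.IsSymm →
      (∀ v : Fin n → ℤ, v ≠ 0 → v ⬝ᵥ (Q *ᵥ v) < 0) → |Q.det| = D →
      ∀ χ₀ : Fin n → ℤ, (∀ i : Fin n, χ₀ i ≡ Q i i [ZMOD 2]) →
      ∃ v : Fin n → ℤ,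
        ((fun i => ((χ₀ + 2 • (Q *ᵥ v)) i : ℚ)) ⬝ᵥ
            ((Q.map (Int.cast : ℤ → ℚ))⁻¹ *ᵥ fun i => ((χ₀ + 2 • (Q *ᵥ v)) i : ℚ)) +
          (n : ℚ)) / 4 ≥ C := by
  choose K hK0 hK using fun n => qa_cover n D
  refine ⟨-∑ n ∈ Finset.range D.toNat, K n, fun n hn Q hQs hQn hdet χ₀ _ => ?_⟩
  have hKle : K n ≤ ∑ n ∈ Finset.range D.toNat, K n :=
    Finset.single_le_sum (fun i _ => hK0 i) (Finset.mem_range.2 (by omega))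
  set Qq := Q.map (Int.cast : ℤ → ℚ) with hQq
  have hunit : IsUnit Qq.det := by
    have : Qq.det = ((Q.det : ℤ) : ℚ) := by
      simpa [Qq] using (Int.cast_det (R := ℚ) Q).symm
    rw [this, isUnit_iff_ne_zero]
    intro h
    have h' : Q.det = 0 := by exact_mod_cast h
    rw [h'] at hdet
    simp at hdet
    omega
  have hP : QAPD (-Q) := by
    refine ⟨by simpa [Matrix.IsSymm] using hQs, fun v hv => ?_⟩
    have := hQn v hv
    simpa [neg_mulVec] using this
  have hPd : (-Q).det ≤ D := by
    rw [← hdet, det_neg]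
    refine (le_abs_self _).trans ?_
    simp [abs_mul]
  let χq : Fin n → ℚ := fun i => (χ₀ i : ℚ)
  obtain ⟨v, hv⟩ := hK n (-Q) hP hPd (-((1 / 2 : ℚ) • (Qq⁻¹ *ᵥ χq)))
  refine ⟨v, ?_⟩
  set vq : Fin n → ℚ := fun i => (v i : ℚ) with hvq
  set d := -((1 / 2 : ℚ) • (Qq⁻¹ *ᵥ χq)) - vq with hd
  have hχ : (fun i => ((χ₀ + 2 • (Q *ᵥ v)) i : ℚ)) = Qq *ᵥ ((-2 : ℚ) • d) := by
    have e1 : (-2 : ℚ) • d = Qq⁻¹ *ᵥ χq + (2 : ℚ) • vq := by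
      rw [hd]; ext i; simp; ring
    rw [e1, mulVec_add, mulVec_mulVec, mul_nonsing_inv _ hunit, one_mulVec]
    funext i
    simp [χq, Qq, vq, mulVec, dotProduct, Finset.mul_sum]
    refine Finset.sum_congr rfl fun _ _ => by ring
  rw [hχ, mulVec_mulVec, nonsing_inv_mul _ hunit, one_mulVec, dotProduct_comm]
  have hmap : (-Q).map (Int.cast : ℤ → ℚ) = -Qq := by
    ext i j; simp [Qq]
  rw [hmap, neg_mulVec, dotProduct_neg] at hv
  have e2 : ((-2 : ℚ) • d) ⬝ᵥ (Qq *ᵥ ((-2 : ℚ) • d)) = 4 * (d ⬝ᵥ (Qq *ᵥ d)) := by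
    rw [mulVec_smul, smul_dotProduct, dotProduct_smul]
    simp only [smul_eq_mul]; ring
  rw [e2]
  have : (0 : ℚ) ≤ n := by positivity
  linarith
end

section
/- For every natural number n, the cokernel of the ℤ-linear map (Fin 4 → ℤ) → (Fin 4 → ℤ) given by the matrix A(n) with rows (−10n+2, 10n, 0, −1), (10n, −10n−2, 1, 0), (0, 1, 10n, −10n−3), (−1, 0, −10n−3, 10n+6) is isomorphic, as an additive group, to ZMod 25. In particular this cokernel is cyclic of order 25, independent of n. -/
/-- The cokernel of the `ℤ`-linear map given by the presentation matrix `A(n)` of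
`H₁(M_n; ℤ)`, where `M_n` is the double branched cover of the Kanenobu knot
`K_{-10n, 10n+3}`, is isomorphic as an additive group to `ZMod 25`, for every `n : ℕ`. -/
theorem kanenobu_homology_cokernel (n : ℕ) :
    Nonempty (((Fin 4 → ℤ) ⧸ LinearMap.range (Matrix.toLin'
      (!![-10 * (n : ℤ) + 2, 10 * (n : ℤ), 0, -1;
          10 * (n : ℤ), -10 * (n : ℤ) - 2, 1, 0;
          0, 1, 10 * (n : ℤ), -10 * (n : ℤ) - 3;
          -1, 0, -10 * (n : ℤ) - 3, 10 * (n : ℤ) + 6]))) ≃+ ZMod 25) := by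
  let φ : (Fin 4 → ℤ) →ₗ[ℤ] ZMod 25 :=
    (Int.castAddHom (ZMod 25)).toIntLinearMap ∘ₗ
      ((-4 : ℤ) • LinearMap.proj 0 + LinearMap.proj 1 + (2 : ℤ) • LinearMap.proj 2
        + (-8 : ℤ) • LinearMap.proj 3)
  have hφ : ∀ v, φ v = ((-4 * v 0 + v 1 + 2 * v 2 + -8 * v 3 : ℤ) : ZMod 25) := by
    intro v
    simp [φ]
  have hs : Function.Surjective φ := by
    intro z
    obtain ⟨k, rfl⟩ := ZMod.intCast_surjective z
    refine ⟨![0, k, 0, 0], ?_⟩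
    rw [hφ]
    simp
  refine ⟨((Submodule.quotEquivOfEq _ _ ?_).trans
    (φ.quotKerEquivOfSurjective hs)).toAddEquiv⟩
  ext v
  rw [LinearMap.mem_ker, hφ, ZMod.intCast_zmod_eq_zero_iff_dvd, LinearMap.mem_range]
  constructor
  · rintro ⟨w, rfl⟩
    refine ⟨2 * n * w 0 - 2 * n * w 1 + (4 * n + 1) * w 2 - (4 * n + 2) * w 3, ?_⟩
    simp [Matrix.toLin'_apply, Matrix.mulVec, dotProduct, Fin.sum_univ_four]
    ring
  · rintro ⟨k, hk⟩
    obtain ⟨m, hm⟩ : ∃ m : ℤ, m = k + 2 * n * (v 2 + v 3) := ⟨_, rfl⟩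
    obtain ⟨u, hu⟩ : ∃ u : ℤ, u = v 0 + (2 - 10 * n) * v 3 - 10 * n * v 2 := ⟨_, rfl⟩
    obtain ⟨p, hp⟩ : ∃ p : ℤ, p = (2 * n - 2) * u - (11 - 10 * n) * m := ⟨_, rfl⟩
    obtain ⟨q, hq⟩ : ∃ q : ℤ, q = (2 * n - 1) * u + (10 * n - 6) * m := ⟨_, rfl⟩
    have h1 : v 1 = 25 * k + 4 * v 0 - 2 * v 2 + 8 * v 3 := by push_cast at hk; linarith
    refine ⟨![-v 3 - (10 * n + 3) * p + (10 * n + 6) * q,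
      v 2 - 10 * n * p + (10 * n + 3) * q, p, q], ?_⟩
    ext i
    fin_cases i <;>
      simp [Matrix.toLin'_apply, Matrix.mulVec, dotProduct, Fin.sum_univ_four] <;>
      (try rw [h1]) <;> subst hp hq hu hm <;> ring
end

section
/- For every natural number n, in the quotient group (Fin 4 → ℤ) ⧸ range(A(n)), where A(n) has rows (−10n+2, 10n, 0, −1), (10n, −10n−2, 1, 0), (0, 1, 10n, −10n−3), (−1, 0, −10n−3, 10n+6), the classes of the standard basis vectors satisfy [e₁] = 13 • [e₄], [e₂] = 3 • [e₄], [e₃] = 6 • [e₄], and the class [e₄] generates the quotient group. -/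
/-- In the quotient of `ℤ⁴` by the range of the presentation matrix `A(n)` of
`H₁(M_n; ℤ)` (the double branched cover of the Kanenobu knot `K_{-10n, 10n+3}`), the
classes of the standard basis vectors satisfy `[e₁] = 13 • [e₄]`, `[e₂] = 3 • [e₄]`,
`[e₃] = 6 • [e₄]`, and `[e₄]` generates the quotient group. -/
theorem kanenobu_homology_generators (n : ℕ) :
    ∀ R : Submodule ℤ (Fin 4 → ℤ), R = LinearMap.range (Matrix.toLin'
      (!![-10 * (n : ℤ) + 2, 10 * (n : ℤ), 0, -1;
          10 * (n : ℤ), -10 * (n : ℤ) - 2, 1, 0;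
          0, 1, 10 * (n : ℤ), -10 * (n : ℤ) - 3;
          -1, 0, -10 * (n : ℤ) - 3, 10 * (n : ℤ) + 6])) →
    (Submodule.Quotient.mk (p := R) (Pi.single 0 1) =
        (13 : ℤ) • Submodule.Quotient.mk (p := R) (Pi.single 3 1)) ∧
    (Submodule.Quotient.mk (p := R) (Pi.single 1 1) =
        (3 : ℤ) • Submodule.Quotient.mk (p := R) (Pi.single 3 1)) ∧
    (Submodule.Quotient.mk (p := R) (Pi.single 2 1) =
        (6 : ℤ) • Submodule.Quotient.mk (p := R) (Pi.single 3 1)) ∧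
    (∀ x : (Fin 4 → ℤ) ⧸ R, ∃ k : ℤ,
        x = k • Submodule.Quotient.mk (p := R) (Pi.single 3 1)) := by
  intro R hR
  have key : ∀ (i : Fin 4) (k : ℤ) (v : Fin 4 → ℤ),
      (Matrix.toLin' (!![-10 * (n : ℤ) + 2, 10 * (n : ℤ), 0, -1;
          10 * (n : ℤ), -10 * (n : ℤ) - 2, 1, 0;
          0, 1, 10 * (n : ℤ), -10 * (n : ℤ) - 3;
          -1, 0, -10 * (n : ℤ) - 3, 10 * (n : ℤ) + 6])) v
        = Pi.single i 1 - k • Pi.single 3 1 →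
      Submodule.Quotient.mk (p := R) (Pi.single i 1) =
        k • Submodule.Quotient.mk (p := R) (Pi.single 3 1) := by
    intro i k v hv
    rw [← Submodule.Quotient.mk_smul, Submodule.Quotient.eq, hR]
    exact ⟨v, hv⟩
  have h0 := key 0 13 ![1 - 2 * n, 3 - 2 * n, 6 + 16 * n, 1 + 16 * n] (by
    ext j
    fin_cases j <;>
      simp [Matrix.mulVec, dotProduct, Fin.sum_univ_four, Pi.single_apply] <;> ring)
  have h1 := key 1 3 ![2 * n, 2 * n, 1 + 4 * n, 4 * n] (by
    ext j
    fin_cases j <;>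
      simp [Matrix.mulVec, dotProduct, Fin.sum_univ_four, Pi.single_apply] <;> ring)
  have h2 := key 2 6 ![- 2 * n, 1 - 2 * n, 2 + 6 * n, 6 * n] (by
    ext j
    fin_cases j <;>
      simp [Matrix.mulVec, dotProduct, Fin.sum_univ_four, Pi.single_apply] <;> ring)
  refine ⟨h0, h1, h2, fun x => ?_⟩
  obtain ⟨y, rfl⟩ := Submodule.Quotient.mk_surjective R x
  refine ⟨y 0 * 13 + y 1 * 3 + y 2 * 6 + y 3, ?_⟩
  have hy : y = y 0 • Pi.single 0 1 + y 1 • Pi.single 1 1 + y 2 • Pi.single 2 1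
      + y 3 • Pi.single 3 1 := by
    ext j
    fin_cases j <;> simp [Pi.single_apply]
  conv_lhs => rw [hy]
  simp only [Submodule.Quotient.mk_add, Submodule.Quotient.mk_smul, h0, h1, h2]
  simp only [add_smul, mul_smul]
end
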